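/- (Greedy protocol yields a feasible trajectory.) For any initial state x(0) ∈ [0, B], the battery state sequence x produced by the greedy charging protocol satisfies 0 ≤ x(n) ≤ B and |x(n) − α·x(n−1)| ≤ Δ·P for all n = 1,…,N; consequently the triple (x, g, l) produced by the greedy protocol is a feasible trajectory for parameters (B, P). -/

import Mathlib

open Finset

/-- A feasible trajectory for a battery with energy rating `B`, power rating `P`,
loss factor `α`, time step `Δ`, wind `w` and demand `d`, over time horizon `N`:
state `x : {0,…,N} → ℝ`, peaker energy `g` and lost wind energy `l` on `{1,…,N}`. -/
def Feasible (N : ℕ) (Δ α B P : ℝ) (w d : ℕ → ℝ) (x g l : ℕ → ℝ) : Prop :=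
  (∀ n, 1 ≤ n → n ≤ N → 0 ≤ g n) ∧
  (∀ n, 1 ≤ n → n ≤ N → 0 ≤ l n) ∧
  (∀ m, m ≤ N → 0 ≤ x m ∧ x m ≤ B) ∧
  (∀ n, 1 ≤ n → n ≤ N → |x n - α * x (n - 1)| ≤ Δ * P) ∧
  (∀ n, 1 ≤ n → n ≤ N → x n = α * x (n - 1) + (w n - d n) + (g n - l n))

/-- Battery state sequence of the greedy charging protocol:
`x(n)` is `α·x(n−1) + (w n − d n)` clamped to
`[max(0, α·x(n−1) − Δ·P), min(B, α·x(n−1) + Δ·P)]`. -/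
noncomputable def greedyX (Δ α B P : ℝ) (w d : ℕ → ℝ) (x0 : ℝ) : ℕ → ℝ
  | 0 => x0
  | n + 1 =>
      min (min B (α * greedyX Δ α B P w d x0 n + Δ * P))
        (max (max 0 (α * greedyX Δ α B P w d x0 n - Δ * P))
          (α * greedyX Δ α B P w d x0 n + (w (n + 1) - d (n + 1))))

/-- Peaker energy of the greedy charging protocol. -/
noncomputable def greedyG (Δ α B P : ℝ) (w d : ℕ → ℝ) (x0 : ℝ) (n : ℕ) : ℝ :=
  if w n < d n then
    greedyX Δ α B P w d x0 n - α * greedyX Δ α B P w d x0 (n - 1) + (d n - w n)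
  else 0

/-- Lost wind energy of the greedy charging protocol. -/
noncomputable def greedyL (Δ α B P : ℝ) (w d : ℕ → ℝ) (x0 : ℝ) (n : ℕ) : ℝ :=
  if d n < w n then
    -(greedyX Δ α B P w d x0 n - α * greedyX Δ α B P w d x0 (n - 1) + (d n - w n))
  else 0

/-- Clamping `y + e` to `[max 0 (y - q), min B (y + q)]`, where `y ∈ [0, B]`, gives a value in
`[0, B]` within `q` of `y` that lies between `y` and `y + e`. -/
theorem clamp_bounds {B q y : ℝ} (e : ℝ) (hq : 0 ≤ q) (hy : 0 ≤ y) (hyB : y ≤ B) :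
    let z := min (min B (y + q)) (max (max 0 (y - q)) (y + e))
    (0 ≤ z ∧ z ≤ B) ∧ |z - y| ≤ q ∧ (e ≤ 0 → y + e ≤ z ∧ z ≤ y) ∧
      (0 ≤ e → y ≤ z ∧ z ≤ y + e) := by
  intro z
  have hlow : max 0 (y - q) ≤ y := max_le hy (by linarith)
  have hupp : y ≤ min B (y + q) := le_min hyB (by linarith)
  have hz_low : max 0 (y - q) ≤ z := le_min (hlow.trans hupp) (le_max_left _ _)
  have hz_upp : z ≤ min B (y + q) := min_le_left _ _
  obtain ⟨h0, h1⟩ := max_le_iff.mp hz_low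
  obtain ⟨h2, h3⟩ := le_min_iff.mp hz_upp
  refine ⟨⟨h0, h2⟩, abs_le.mpr ⟨by linarith, by linarith⟩, fun he => ⟨?_, ?_⟩,
    fun he => ⟨?_, ?_⟩⟩
  · exact le_min (by linarith) (le_max_right _ _)
  · exact (min_le_right _ _).trans (max_le hlow (by linarith))
  · exact le_min hupp (le_max_of_le_right (by linarith))
  · exact (min_le_right _ _).trans (max_le (by linarith) le_rfl)

theorem greedyX_mem_Icc {Δ α B P : ℝ} (hα0 : 0 ≤ α) (hα1 : α ≤ 1) (hΔP : 0 ≤ Δ * P)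
    (w d : ℕ → ℝ) {x0 : ℝ} (hx0 : 0 ≤ x0) (hx0B : x0 ≤ B) (n : ℕ) :
    0 ≤ greedyX Δ α B P w d x0 n ∧ greedyX Δ α B P w d x0 n ≤ B := by
  induction n with
  | zero => exact ⟨hx0, hx0B⟩
  | succ n ih =>
    exact (clamp_bounds _ hΔP (mul_nonneg hα0 ih.1)
      ((mul_le_of_le_one_left ih.1 hα1).trans ih.2)).1

/-- The greedy charging protocol yields a feasible trajectory: for any initial state
`x0 ∈ [0, B]`, the greedy state satisfies `0 ≤ x n ≤ B` and
`|x n − α·x (n−1)| ≤ Δ·P` for all `n = 1,…,N`, and `(x, g, l)` is feasible. -/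
theorem stmt14 (N : ℕ) (hN : 1 ≤ N) (Δ : ℝ) (hΔ : 0 < Δ)
    (α B P : ℝ) (hα0 : 0 ≤ α) (hα1 : α ≤ 1) (hB : 0 ≤ B) (hP : 0 ≤ P)
    (w d : ℕ → ℝ) (x0 : ℝ) (hx0 : 0 ≤ x0) (hx0B : x0 ≤ B) :
    (∀ n, 1 ≤ n → n ≤ N →
        (0 ≤ greedyX Δ α B P w d x0 n ∧ greedyX Δ α B P w d x0 n ≤ B) ∧
        |greedyX Δ α B P w d x0 n - α * greedyX Δ α B P w d x0 (n - 1)| ≤ Δ * P) ∧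
    Feasible N Δ α B P w d (greedyX Δ α B P w d x0)
      (greedyG Δ α B P w d x0) (greedyL Δ α B P w d x0) := by
  have hΔP : 0 ≤ Δ * P := mul_nonneg hΔ.le hP
  have hmem := greedyX_mem_Icc hα0 hα1 hΔP w d hx0 hx0B
  have hstep : ∀ n, 1 ≤ n →
      let x := greedyX Δ α B P w d x0 n
      let y := α * greedyX Δ α B P w d x0 (n - 1)
      |x - y| ≤ Δ * P ∧ (w n - d n ≤ 0 → y + (w n - d n) ≤ x ∧ x ≤ y) ∧
        (0 ≤ w n - d n → y ≤ x ∧ x ≤ y + (w n - d n)) := by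
    intro n hn
    obtain ⟨m, rfl⟩ := Nat.exists_eq_add_of_le' hn
    obtain ⟨h0, h1⟩ := hmem m
    exact (clamp_bounds _ hΔP (mul_nonneg hα0 h0)
      ((mul_le_of_le_one_left h0 hα1).trans h1)).2
  refine ⟨fun n hn _ => ⟨hmem n, (hstep n hn).1⟩, fun n hn _ => ?_, fun n hn _ => ?_,
    fun m _ => hmem m, fun n hn _ => (hstep n hn).1, fun n hn _ => ?_⟩
  · unfold greedyG
    split_ifs with h
    · have := ((hstep n hn).2.1 (by linarith)).1
      linarith
    · exact le_rfl
  · unfold greedyL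
    split_ifs with h
    · have := ((hstep n hn).2.2 (by linarith)).2
      linarith
    · exact le_rfl
  · unfold greedyG greedyL
    rcases lt_trichotomy (w n) (d n) with h | h | h
    · rw [if_pos h, if_neg h.not_gt]
      ring
    · have hle := ((hstep n hn).2.1 (by linarith)).2
      have hge := ((hstep n hn).2.2 (by linarith)).1
      rw [if_neg h.not_lt, if_neg h.not_gt]
      linarith
    · rw [if_neg h.not_gt, if_pos h]
      ring
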